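/- arXiv:2604.12212 — 7 statements merged into one kernel-verified Lean document; each statement's English description precedes it below -/
import Mathlib

section
/- If f : ℝ → ℝ is L-Lipschitz and A, B ∈ Mₙ(ℂ) are Hermitian matrices, then ‖f(A) − f(B)‖_F ≤ L · ‖A − B‖_F, where f(A) and f(B) are defined by the functional calculus for Hermitian matrices. -/
open Matrix

/-- The Frobenius norm of a complex matrix: `‖A‖_F = (Tr(AᴴA))^{1/2}`. -/
noncomputable def frobNorm {n : Type*} [Fintype n] (A : Matrix n n ℂ) : ℝ :=
  Real.sqrt (Matrix.trace (Aᴴ * A)).re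

lemma frob_trace_eq {n : Type*} [Fintype n] (X : Matrix n n ℂ) :
    (Matrix.trace (Xᴴ * X)).re = ∑ j, ∑ i, Complex.normSq (X i j) := by
  simp [Matrix.trace, Matrix.mul_apply, Complex.normSq_apply]

lemma frob_diag_eq {n : Type*} [Fintype n] [DecidableEq n]
    (U V : Matrix n n ℂ) (hU : Uᴴ * U = 1) (hU' : U * Uᴴ = 1) (hV : Vᴴ * V = 1)
    (hV' : V * Vᴴ = 1) (d e : n → ℝ) :
    frobNorm (U * diagonal (fun i => (d i : ℂ)) * Uᴴ - V * diagonal (fun i => (e i : ℂ)) * Vᴴ) =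
      Real.sqrt (∑ j, ∑ i, (d i - e j) ^ 2 * Complex.normSq ((Uᴴ * V) i j)) := by
  set X := U * diagonal (fun i => (d i : ℂ)) * Uᴴ - V * diagonal (fun i => (e i : ℂ)) * Vᴴ with hX
  have h1 : Uᴴ * X * V = diagonal (fun i => (d i : ℂ)) * (Uᴴ * V)
      - (Uᴴ * V) * diagonal (fun i => (e i : ℂ)) := by
    rw [hX, Matrix.mul_sub, Matrix.sub_mul]
    congr 1
    · simp only [← Matrix.mul_assoc]
      rw [hU, Matrix.one_mul]
    · simp only [Matrix.mul_assoc]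
      rw [hV, Matrix.mul_one]
  have h2 : Matrix.trace (Xᴴ * X) = Matrix.trace ((Uᴴ * X * V)ᴴ * (Uᴴ * X * V)) := by
    have : (Uᴴ * X * V)ᴴ * (Uᴴ * X * V) = Vᴴ * (Xᴴ * (U * Uᴴ) * X * V) := by
      simp only [Matrix.conjTranspose_mul, Matrix.conjTranspose_conjTranspose, Matrix.mul_assoc]
    rw [this, hU', Matrix.trace_mul_comm Vᴴ, Matrix.mul_one, Matrix.mul_assoc _ V, hV', Matrix.mul_one]
  unfold frobNorm
  rw [h2, frob_trace_eq, h1]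
  congr 1
  refine Finset.sum_congr rfl fun j _ => Finset.sum_congr rfl fun i _ => ?_
  have : (diagonal (fun i => (d i : ℂ)) * (Uᴴ * V)
      - (Uᴴ * V) * diagonal (fun i => (e i : ℂ))) i j = ((d i - e j : ℝ) : ℂ) * (Uᴴ * V) i j := by
    rw [Matrix.sub_apply, Matrix.diagonal_mul, Matrix.mul_diagonal]
    push_cast
    ring
  rw [this, Complex.normSq_mul, Complex.normSq_ofReal]
  ring

/-- If `f : ℝ → ℝ` is `L`-Lipschitz and `A, B` are Hermitian `n × n` complex matrices,
then `‖f(A) − f(B)‖_F ≤ L · ‖A − B‖_F`, where `f(A)` and `f(B)` are defined via the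
functional calculus for Hermitian matrices. -/
theorem lipschitz_functional_calculus_matrix
    {n : Type*} [Fintype n] [DecidableEq n]
    (f : ℝ → ℝ) (L : ℝ) (hL : 0 ≤ L)
    (hf : ∀ s t : ℝ, |f s - f t| ≤ L * |s - t|)
    (A B : Matrix n n ℂ) (hA : A.IsHermitian) (hB : B.IsHermitian) :
    frobNorm (hA.cfc f - hB.cfc f) ≤ L * frobNorm (A - B) := by
  have key := frob_diag_eq (hA.eigenvectorUnitary : Matrix n n ℂ) hB.eigenvectorUnitary
    (Unitary.coe_star_mul_self _) (Unitary.coe_mul_star_self _)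
    (Unitary.coe_star_mul_self _) (Unitary.coe_mul_star_self _)
  have e1 := key (fun i => f (hA.eigenvalues i)) (fun i => f (hB.eigenvalues i))
  have e2 := key hA.eigenvalues hB.eigenvalues
  have a1 : ∀ {C : Matrix n n ℂ} (hC : C.IsHermitian), hC.cfc f =
      (hC.eigenvectorUnitary : Matrix n n ℂ) * diagonal (fun i => ((f (hC.eigenvalues i) : ℝ) : ℂ))
        * (hC.eigenvectorUnitary : Matrix n n ℂ)ᴴ := by
    intro C hC
    rw [Matrix.IsHermitian.cfc, Unitary.conjStarAlgAut_apply]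
    rfl
  have a2 : ∀ {C : Matrix n n ℂ} (hC : C.IsHermitian), C =
      (hC.eigenvectorUnitary : Matrix n n ℂ) * diagonal (fun i => ((hC.eigenvalues i : ℝ) : ℂ))
        * (hC.eigenvectorUnitary : Matrix n n ℂ)ᴴ := by
    intro C hC
    have := hC.spectral_theorem
    rw [Unitary.conjStarAlgAut_apply] at this
    exact this
  rw [← a1 hA, ← a1 hB] at e1
  rw [← a2 hA, ← a2 hB] at e2
  rw [e1, e2]
  refine Real.sqrt_le_iff.mpr ⟨by positivity, ?_⟩
  rw [mul_pow, Real.sq_sqrt (Finset.sum_nonneg fun j _ => Finset.sum_nonneg fun i _ =>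
    mul_nonneg (sq_nonneg _) (Complex.normSq_nonneg _)), Finset.mul_sum]
  refine Finset.sum_le_sum fun j _ => ?_
  rw [Finset.mul_sum]
  refine Finset.sum_le_sum fun i _ => ?_
  rw [← mul_assoc]
  refine mul_le_mul_of_nonneg_right ?_ (Complex.normSq_nonneg _)
  rw [← mul_pow]
  refine sq_le_sq.mpr ?_
  rw [abs_mul, abs_of_nonneg hL]
  exact hf _ _
end

section
/- Let R > 0 and let X ∈ Mₙ(ℂ) admit a polar decomposition X = U·P with U unitary and P Hermitian positive semidefinite. Set X' = U·F_R(P), where F_R is applied to P by the functional calculus. Then ‖X'‖_op ≤ R, and for every Y ∈ Mₙ(ℂ) with ‖Y‖_op ≤ R one has ‖X − X'‖_F ≤ ‖X − Y‖_F, with equality only when Y = X'. In other words, X' is the unique nearest point to X, in Frobenius distance, in the operator-norm ball of radius R in Mₙ(ℂ). -/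
open Matrix
open scoped ComplexOrder

/-- The ℓ²→ℓ² operator norm of a complex matrix (largest singular value). -/
noncomputable def opNorm {n : Type*} [Fintype n] [DecidableEq n] (A : Matrix n n ℂ) : ℝ :=
  ‖Matrix.toEuclideanCLM (𝕜 := ℂ) (n := n) A‖

/-- The truncation function `F_R(t) = min(max(t, −R), R)`. -/
def truncFn (R t : ℝ) : ℝ := min (max t (-R)) R

section helpers

variable {n : Type*} [Fintype n]

lemma frobNorm_eq_sum (A : Matrix n n ℂ) :
    frobNorm A = Real.sqrt (∑ i, ∑ j, Complex.normSq (A i j)) := by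
  unfold frobNorm
  congr 1
  rw [Finset.sum_comm]
  simp only [Matrix.trace, Matrix.diag, Matrix.mul_apply, Matrix.conjTranspose_apply,
    Complex.re_sum]
  refine Finset.sum_congr rfl fun i _ => Finset.sum_congr rfl fun j _ => ?_
  simp [Complex.normSq_apply]

variable [DecidableEq n]

lemma frobNorm_unitary (W V A : Matrix n n ℂ) (hW : Wᴴ * W = 1) (hV : Vᴴ * V = 1) :
    frobNorm (W * A * Vᴴ) = frobNorm A := by
  unfold frobNorm
  congr 2
  have h : (W * A * Vᴴ)ᴴ * (W * A * Vᴴ) = V * (Aᴴ * A * Vᴴ) := by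
    simp only [Matrix.conjTranspose_mul, Matrix.conjTranspose_conjTranspose]
    calc V * (Aᴴ * Wᴴ) * (W * A * Vᴴ) = V * (Aᴴ * (Wᴴ * W) * A * Vᴴ) := by
          simp only [Matrix.mul_assoc]
      _ = _ := by rw [hW, Matrix.mul_one]
  rw [h, Matrix.trace_mul_comm, Matrix.mul_assoc, hV, Matrix.mul_one]

open scoped Matrix.Norms.L2Operator in
lemma opNorm_eq_norm (A : Matrix n n ℂ) : opNorm A = ‖A‖ := rfl

open scoped Matrix.Norms.L2Operator in
lemma opNorm_unitary (W V A : Matrix n n ℂ) (hW : W ∈ unitary (Matrix n n ℂ))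
    (hV : V ∈ unitary (Matrix n n ℂ)) :
    opNorm (W * A * V) = opNorm A := by
  rw [opNorm_eq_norm, opNorm_eq_norm, CStarRing.norm_mul_mem_unitary _ hV,
    CStarRing.norm_mem_unitary_mul _ hW]

open scoped Matrix.Norms.L2Operator in
lemma opNorm_diagonal_le (d : n → ℂ) (R : ℝ) (hR : 0 ≤ R) (h : ∀ i, ‖d i‖ ≤ R) :
    opNorm (Matrix.diagonal d) ≤ R := by
  rw [opNorm_eq_norm, Matrix.l2_opNorm_diagonal]
  exact (pi_norm_le_iff_of_nonneg hR).2 h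

lemma entry_le_opNorm (A : Matrix n n ℂ) (i j : n) : ‖A i j‖ ≤ opNorm A := by
  have h := (Matrix.toEuclideanCLM (𝕜 := ℂ) (n := n) A).le_opNorm (EuclideanSpace.single j 1)
  rw [EuclideanSpace.norm_single, norm_one, mul_one] at h
  refine le_trans ?_ h
  refine le_trans (le_of_eq ?_) (PiLp.norm_apply_le _ i)
  simp

lemma scalar_ineq (R t : ℝ) (hR : 0 < R) (ht : 0 ≤ t) (z : ℂ) (hz : ‖z‖ ≤ R) :
    Complex.normSq ((t : ℂ) - (truncFn R t : ℝ)) + Complex.normSq ((truncFn R t : ℝ) - z)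
      ≤ Complex.normSq (t - z) := by
  have hre : z.re ≤ R := (Complex.re_le_norm z).trans hz
  have h1 : truncFn R t = min t R := by
    unfold truncFn
    rw [max_eq_left (by linarith)]
  rw [h1]
  simp only [Complex.normSq_apply, Complex.sub_re, Complex.sub_im, Complex.ofReal_re,
    Complex.ofReal_im]
  rcases le_total t R with h | h
  · rw [min_eq_left h]; nlinarith
  · rw [min_eq_right h]; nlinarith [mul_nonneg (sub_nonneg.2 h) (sub_nonneg.2 hre)]

lemma diag_ineq (R : ℝ) (hR : 0 < R) (d : n → ℝ) (hd : ∀ i, 0 ≤ d i) (Z : Matrix n n ℂ)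
    (hZ : opNorm Z ≤ R) :
    ∑ i, ∑ j, Complex.normSq ((diagonal (fun i => (d i : ℂ)) -
        diagonal (fun i => ((truncFn R (d i) : ℝ) : ℂ))) i j) +
      ∑ i, ∑ j, Complex.normSq ((diagonal (fun i => ((truncFn R (d i) : ℝ) : ℂ)) - Z) i j) ≤
      ∑ i, ∑ j, Complex.normSq ((diagonal (fun i => (d i : ℂ)) - Z) i j) := by
  simp only [← Finset.sum_add_distrib]
  refine Finset.sum_le_sum fun i _ => Finset.sum_le_sum fun j _ => ?_
  by_cases h : i = j
  · subst h
    simpa using scalar_ineq R (d i) hR (hd i) (Z i i) ((entry_le_opNorm Z i i).trans hZ)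
  · simp [h]

lemma diag_main (R : ℝ) (hR : 0 < R) (d : n → ℝ) (hd : ∀ i, 0 ≤ d i) (Z : Matrix n n ℂ)
    (hZ : opNorm Z ≤ R) :
    frobNorm (diagonal (fun i => (d i : ℂ)) - diagonal (fun i => ((truncFn R (d i) : ℝ) : ℂ)))
      ≤ frobNorm (diagonal (fun i => (d i : ℂ)) - Z) ∧
    (frobNorm (diagonal (fun i => (d i : ℂ)) - diagonal (fun i => ((truncFn R (d i) : ℝ) : ℂ)))
      = frobNorm (diagonal (fun i => (d i : ℂ)) - Z) →
      Z = diagonal (fun i => ((truncFn R (d i) : ℝ) : ℂ))) := by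
  have key := diag_ineq R hR d hd Z hZ
  have nn : ∀ A : Matrix n n ℂ, 0 ≤ ∑ i, ∑ j, Complex.normSq (A i j) := fun A =>
    Finset.sum_nonneg fun i _ => Finset.sum_nonneg fun j _ => Complex.normSq_nonneg _
  have h2 := nn (diagonal (fun i => ((truncFn R (d i) : ℝ) : ℂ)) - Z)
  simp only [frobNorm_eq_sum]
  refine ⟨Real.sqrt_le_sqrt (by linarith), fun h => ?_⟩
  rw [Real.sqrt_inj (nn _) (nn _)] at h
  have h0 : ∑ i, ∑ j, Complex.normSq
      ((diagonal (fun i => ((truncFn R (d i) : ℝ) : ℂ)) - Z) i j) = 0 := by linarith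
  have h0' := (Finset.sum_eq_zero_iff_of_nonneg
    (fun i _ => Finset.sum_nonneg fun j _ => Complex.normSq_nonneg _)).1 h0
  ext i j
  have h1 := (Finset.sum_eq_zero_iff_of_nonneg (fun j _ => Complex.normSq_nonneg _)).1
    (h0' i (Finset.mem_univ _))
  have h3 := Complex.normSq_eq_zero.1 (h1 j (Finset.mem_univ _))
  rw [Matrix.sub_apply, sub_eq_zero] at h3
  exact h3.symm

end helpers

/-- Let `X = U·P` be a polar decomposition with `U` unitary and `P` Hermitian positive
semidefinite, and set `X' = U·F_R(P)` (functional calculus).  Then `‖X'‖_op ≤ R`, and `X'`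
is the unique nearest point to `X` in Frobenius distance among matrices of operator
norm at most `R`. -/
theorem nearest_point_in_opNorm_ball
    {n : Type*} [Fintype n] [DecidableEq n]
    (R : ℝ) (hR : 0 < R)
    (X U P : Matrix n n ℂ)
    (hU : U ∈ Matrix.unitaryGroup n ℂ)
    (hP : P.PosSemidef) (hX : X = U * P) :
    opNorm (U * hP.1.cfc (truncFn R)) ≤ R ∧
    ∀ Y : Matrix n n ℂ, opNorm Y ≤ R →
      frobNorm (X - U * hP.1.cfc (truncFn R)) ≤ frobNorm (X - Y) ∧
      (frobNorm (X - U * hP.1.cfc (truncFn R)) = frobNorm (X - Y) →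
        Y = U * hP.1.cfc (truncFn R)) := by
  obtain ⟨V, hVdef⟩ : ∃ V : Matrix n n ℂ, V = hP.1.eigenvectorUnitary := ⟨_, rfl⟩
  have hVu : V ∈ unitary (Matrix n n ℂ) := hVdef ▸ hP.1.eigenvectorUnitary.2
  have hWu : U * V ∈ unitary (Matrix n n ℂ) := mul_mem hU hVu
  have hV1 : Vᴴ * V = 1 := (Unitary.mem_iff.1 hVu).1
  have hV2 : V * Vᴴ = 1 := (Unitary.mem_iff.1 hVu).2
  have hW1 : (U * V)ᴴ * (U * V) = 1 := (Unitary.mem_iff.1 hWu).1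
  have hW2 : (U * V) * (U * V)ᴴ = 1 := (Unitary.mem_iff.1 hWu).2
  have hVs : Vᴴ ∈ unitary (Matrix n n ℂ) := Unitary.star_mem hVu
  have hWs : (U * V)ᴴ ∈ unitary (Matrix n n ℂ) := Unitary.star_mem hWu
  have hC : U * hP.1.cfc (truncFn R) =
      (U * V) * diagonal (fun i => ((truncFn R (hP.1.eigenvalues i) : ℝ) : ℂ)) * Vᴴ := by
    rw [hVdef, Matrix.mul_assoc, Matrix.mul_assoc, ← Matrix.mul_assoc _ _ (_ᴴ)]
    rfl
  have hX' : X = (U * V) * diagonal (fun i => (hP.1.eigenvalues i : ℂ)) * Vᴴ := by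
    have h : P = V * diagonal (fun i => (hP.1.eigenvalues i : ℂ)) * Vᴴ := by
      rw [hVdef]; exact hP.1.spectral_theorem
    rw [hX, Matrix.mul_assoc U V, Matrix.mul_assoc U, ← h]
  have hd := hP.eigenvalues_nonneg
  generalize hP.1.eigenvalues = d at hC hX' hd
  rw [hC]
  generalize U * V = W at *
  refine ⟨?_, fun Y hY => ?_⟩
  · rw [opNorm_unitary _ _ _ hWu hVs]
    refine opNorm_diagonal_le _ R hR.le fun i => ?_
    rw [Complex.norm_real, Real.norm_eq_abs, abs_le]
    unfold truncFn
    exact ⟨le_min (le_max_right _ _) (by linarith), min_le_right _ _⟩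
  · obtain ⟨Z, hZ⟩ : ∃ Z, Z = Wᴴ * Y * V := ⟨_, rfl⟩
    have hYZ : Y = W * Z * Vᴴ := by
      rw [hZ]
      calc Y = (W * Wᴴ) * Y * (V * Vᴴ) := by rw [hW2, hV2]; simp
        _ = _ := by simp only [Matrix.mul_assoc]
    have hZn : opNorm Z ≤ R := by rw [hZ, opNorm_unitary _ _ _ hWs hVu]; exact hY
    have main := diag_main R hR d hd Z hZn
    rw [hX', hYZ, ← Matrix.sub_mul, ← Matrix.sub_mul, ← Matrix.mul_sub, ← Matrix.mul_sub,
      frobNorm_unitary _ _ _ hW1 hV1, frobNorm_unitary _ _ _ hW1 hV1]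
    exact ⟨main.1, fun h => by rw [main.2 h]⟩
end

section
/- Let R > 0 and define g : ℝ → ℝ by g(t) = −2R − R²/t for t ≤ −R, g(t) = t for −R ≤ t ≤ R, and g(t) = 2R − R²/t for t ≥ R. Then for all real numbers s, t with t < s, one has g(s) − g(t) ≥ (s − t) · R² / (max(|s|, R) · max(|t|, R)). -/
/-- The smooth cutoff function `g(t) = −2R − R²/t` for `t ≤ −R`, `g(t) = t` for
`−R ≤ t ≤ R`, and `g(t) = 2R − R²/t` for `t ≥ R`. -/
noncomputable def smoothCutoff (R t : ℝ) : ℝ :=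
  if t ≤ -R then -2 * R - R ^ 2 / t
  else if t ≤ R then t
  else 2 * R - R ^ 2 / t

/-- Sharp lower bound for the difference quotient of the smooth cutoff function:
for `t < s`, `g(s) − g(t) ≥ (s − t) · R² / (max(|s|, R) · max(|t|, R))`. -/
theorem smoothCutoff_difference_quotient_bound
    (R : ℝ) (hR : 0 < R) (s t : ℝ) (hts : t < s) :
    smoothCutoff R s - smoothCutoff R t ≥
      (s - t) * R ^ 2 / (max |s| R * max |t| R) := by
  rw [ge_iff_le, ← sub_nonneg]
  unfold smoothCutoff
  by_cases hs1 : s ≤ -R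
  · have ht1 : t ≤ -R := by linarith
    have hs0 : s ≠ 0 := by intro h; linarith
    have ht0 : t ≠ 0 := by intro h; linarith
    rw [if_pos hs1, if_pos ht1, abs_of_neg (by linarith), abs_of_neg (by linarith),
      max_eq_left (by linarith), max_eq_left (by linarith)]
    apply le_of_eq
    field_simp
    ring
  · rw [if_neg hs1]
    push Not at hs1
    by_cases hs2 : s ≤ R
    · have hs3 : |s| ≤ R := abs_le.2 ⟨hs1.le, hs2⟩
      rw [if_pos hs2, max_eq_right hs3]
      by_cases ht1 : t ≤ -R
      · have ht0 : t ≠ 0 := by intro h; linarith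
        rw [if_pos ht1, abs_of_neg (by linarith), max_eq_left (by linarith)]
        have key : s - (-2 * R - R ^ 2 / t) - (s - t) * R ^ 2 / (R * -t)
            = (s + R) * (-t - R) / (-t) := by
          field_simp
          ring
        rw [key]
        exact div_nonneg (mul_nonneg (by linarith) (by linarith)) (by linarith)
      · push Not at ht1
        rw [if_neg (not_le.2 ht1), if_pos (by linarith),
          max_eq_right (abs_le.2 ⟨ht1.le, by linarith⟩)]
        apply le_of_eq
        field_simp
        ring
    · rw [if_neg hs2]
      push Not at hs2
      have hs0 : 0 < s := by linarith
      rw [abs_of_pos hs0, max_eq_left hs2.le]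
      by_cases ht1 : t ≤ -R
      · have ht0 : t ≠ 0 := by intro h; linarith
        rw [if_pos ht1, abs_of_neg (by linarith), max_eq_left (by linarith)]
        have key : 2 * R - R ^ 2 / s - (-2 * R - R ^ 2 / t) - (s - t) * R ^ 2 / (s * -t)
            = 2 * R * ((s - R) / s) + 2 * R * ((-t - R) / (-t)) := by
          field_simp
          ring
        rw [key]
        have h1 : 0 ≤ (s - R) / s := div_nonneg (by linarith) (by linarith)
        have h2 : 0 ≤ (-t - R) / (-t) := div_nonneg (by linarith) (by linarith)
        positivity
      · push Not at ht1
        rw [if_neg (not_le.2 ht1)]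
        by_cases ht2 : t ≤ R
        · rw [if_pos ht2, max_eq_right (abs_le.2 ⟨ht1.le, ht2⟩)]
          have key : 2 * R - R ^ 2 / s - t - (s - t) * R ^ 2 / (s * R)
              = (s - R) * (R - t) / s := by
            field_simp
            ring
          rw [key]
          exact div_nonneg (mul_nonneg (by linarith) (by linarith)) hs0.le
        · rw [if_neg ht2]
          push Not at ht2
          have ht0 : 0 < t := by linarith
          rw [abs_of_pos ht0, max_eq_left ht2.le]
          apply le_of_eq
          field_simp
          ring
end

section
/- Let R > 0, let g : ℝ → ℝ be defined by g(t) = −2R − R²/t for t ≤ −R, g(t) = t for −R ≤ t ≤ R, and g(t) = 2R − R²/t for t ≥ R, and let h_R(t) = max(|t| − R, 0). Then for every Hermitian matrix X ∈ Mₙ(ℂ): ‖X‖_F² − ‖g(X)‖_F² ≥ ‖h_R(X)‖_F², where g(X) and h_R(X) are defined by the functional calculus for Hermitian matrices. -/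
open Matrix

/-- The excess function `h_R(t) = max(|t| − R, 0)`. -/
def excessFn (R t : ℝ) : ℝ := max (|t| - R) 0

lemma scalar_pos (R t : ℝ) (hR : 0 < R) (ht : R ≤ t) :
    (2 * R - R ^ 2 / t) ^ 2 + (t - R) ^ 2 ≤ t ^ 2 := by
  have h0 : 0 < t := lt_of_lt_of_le hR ht
  have key : t ^ 2 - ((2 * R - R ^ 2 / t) ^ 2 + (t - R) ^ 2)
      = R * (t - R) ^ 2 * (2 * t - R) / t ^ 2 := by
    field_simp
    ring
  have h2 : 0 ≤ 2 * t - R := by linarith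
  have : 0 ≤ R * (t - R) ^ 2 * (2 * t - R) / t ^ 2 := by positivity
  linarith

lemma scalar_bound (R t : ℝ) (hR : 0 < R) :
    smoothCutoff R t ^ 2 + excessFn R t ^ 2 ≤ t ^ 2 := by
  unfold smoothCutoff excessFn
  split_ifs with h1 h2
  · have h := scalar_pos R (-t) hR (by linarith)
    rw [abs_of_nonpos (by linarith), max_eq_left (by linarith)]
    rw [div_neg] at h
    nlinarith [h]
  · have : |t| ≤ R := abs_le.mpr ⟨by linarith, h2⟩
    rw [max_eq_right (by linarith)]
    simp
  · rw [abs_of_nonneg (by linarith), max_eq_left (by linarith)]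
    exact scalar_pos R t hR (by linarith)

lemma frobNorm_sq_conj {n : Type*} [Fintype n] [DecidableEq n]
    (U : unitary (Matrix n n ℂ)) (d : n → ℝ) :
    frobNorm ((U : Matrix n n ℂ) * diagonal (fun i => (d i : ℂ)) * star (U : Matrix n n ℂ)) ^ 2
      = ∑ i, d i ^ 2 := by
  have hU : star (U : Matrix n n ℂ) * (U : Matrix n n ℂ) = 1 := Unitary.coe_star_mul_self U
  have h : (Matrix.trace (((U : Matrix n n ℂ) * diagonal (fun i => (d i : ℂ)) *
      star (U : Matrix n n ℂ))ᴴ * ((U : Matrix n n ℂ) * diagonal (fun i => (d i : ℂ)) *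
      star (U : Matrix n n ℂ)))) = ((∑ i, d i ^ 2 : ℝ) : ℂ) := by
    rw [← star_eq_conjTranspose, star_mul, star_mul, star_star]
    rw [show ∀ V D E W : Matrix n n ℂ, V * (D * W) * (V * E * W) = V * (D * (W * V) * E * W) by
      intros; simp only [Matrix.mul_assoc], hU, Matrix.trace_mul_comm, Matrix.mul_assoc, hU,
      star_eq_conjTranspose, diagonal_conjTranspose]
    simp [diagonal_mul_diagonal, trace_diagonal, sq]
  unfold frobNorm
  rw [h, Complex.ofReal_re, Real.sq_sqrt (Finset.sum_nonneg fun i _ => sq_nonneg _)]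

lemma frobNorm_sq_cfc {n : Type*} [Fintype n] [DecidableEq n]
    (X : Matrix n n ℂ) (hX : X.IsHermitian) (f : ℝ → ℝ) :
    frobNorm (hX.cfc f) ^ 2 = ∑ i, f (hX.eigenvalues i) ^ 2 :=
  frobNorm_sq_conj hX.eigenvectorUnitary (fun i => f (hX.eigenvalues i))

/-- For every Hermitian matrix `X`,
`‖X‖_F² − ‖g(X)‖_F² ≥ ‖h_R(X)‖_F²`, where `g(X)` and `h_R(X)` are defined via the
functional calculus for Hermitian matrices. -/
theorem smoothCutoff_frobenius_bound
    {n : Type*} [Fintype n] [DecidableEq n]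
    (R : ℝ) (hR : 0 < R) (X : Matrix n n ℂ) (hX : X.IsHermitian) :
    frobNorm X ^ 2 - frobNorm (hX.cfc (smoothCutoff R)) ^ 2 ≥
      frobNorm (hX.cfc (excessFn R)) ^ 2 := by
  have hid : frobNorm X ^ 2 = ∑ i, hX.eigenvalues i ^ 2 := by
    have h := frobNorm_sq_conj hX.eigenvectorUnitary hX.eigenvalues
    rw [← h]
    congr 2
    exact hX.spectral_theorem
  rw [hid, frobNorm_sq_cfc, frobNorm_sq_cfc, ge_iff_le, ← Finset.sum_sub_distrib]
  refine Finset.sum_le_sum fun i _ => ?_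
  linarith [scalar_bound R (hX.eigenvalues i) hR]
end

section
/- Let H be a real inner product space, let a ≥ 0, c > 0 and L ≥ 0, let ψ : H → ℝ be L-Lipschitz, and set φ(x) = ψ(x) + (a/2)‖x‖². Define the inf-convolution e(x) = inf_{v ∈ H} [(c/2)‖v − x‖² + φ(v)]. Then: (i) e(x) is finite for every x ∈ H; (ii) for every x ∈ H, the infimum over all of H equals the infimum of the same expression restricted to the closed ball {v ∈ H : ‖v‖ ≤ (L + c‖x‖)/(c + a)}; (iii) the function x ↦ (c/2)‖x‖² − e(x) is convex, i.e., e is c-semiconcave. -/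
/-- Let `φ(x) = ψ(x) + (a/2)‖x‖²` with `ψ` `L`-Lipschitz, `a ≥ 0` and `c > 0`, and let
`e(x) = inf_v [(c/2)‖v − x‖² + φ(v)]` be the inf-convolution.  Then (i) `e(x)` is finite
for every `x` (the infimum is bounded below); (ii) the infimum over `H` equals the infimum
over the closed ball of radius `(L + c‖x‖)/(c + a)`; (iii) `(c/2)‖·‖² − e` is convex,
i.e. `e` is `c`-semiconcave. -/
theorem inf_convolution_lipschitz_plus_quadratic
    {H : Type*} [NormedAddCommGroup H] [InnerProductSpace ℝ H]
    (a c L : ℝ) (ha : 0 ≤ a) (hc : 0 < c) (hL : 0 ≤ L)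
    (ψ : H → ℝ) (hψ : ∀ u v : H, |ψ u - ψ v| ≤ L * ‖u - v‖) :
    (∀ x : H, BddBelow (Set.range fun v : H =>
        c / 2 * ‖v - x‖ ^ 2 + (ψ v + a / 2 * ‖v‖ ^ 2))) ∧
    (∀ x : H,
      (⨅ v : H, (c / 2 * ‖v - x‖ ^ 2 + (ψ v + a / 2 * ‖v‖ ^ 2))) =
        ⨅ v : {v : H // ‖v‖ ≤ (L + c * ‖x‖) / (c + a)},
          (c / 2 * ‖(v : H) - x‖ ^ 2 + (ψ (v : H) + a / 2 * ‖(v : H)‖ ^ 2))) ∧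
    ConvexOn ℝ Set.univ
      (fun x : H =>
        c / 2 * ‖x‖ ^ 2 - ⨅ v : H, (c / 2 * ‖v - x‖ ^ 2 + (ψ v + a / 2 * ‖v‖ ^ 2))) := by
  have hb : ∀ x : H, BddBelow (Set.range fun v : H =>
        c / 2 * ‖v - x‖ ^ 2 + (ψ v + a / 2 * ‖v‖ ^ 2)) := by
    intro x
    refine ⟨ψ x - L ^ 2 / (2 * c), ?_⟩
    rintro _ ⟨v, rfl⟩
    have h1 := (abs_le.mp (hψ v x)).1
    have h2 : 0 ≤ a / 2 * ‖v‖ ^ 2 := by positivity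
    have h3 : c / 2 * ‖v - x‖ ^ 2 - L * ‖v - x‖ + L ^ 2 / (2 * c)
        = (c * ‖v - x‖ - L) ^ 2 / (2 * c) := by
      field_simp
      ring
    have h4 : 0 ≤ (c * ‖v - x‖ - L) ^ 2 / (2 * c) := by positivity
    simp only
    linarith
  have hexp : ∀ x v : H, ‖v - x‖ ^ 2 = ‖v‖ ^ 2 - 2 * inner ℝ v x + ‖x‖ ^ 2 :=
    fun x v => norm_sub_sq_real v x
  refine ⟨hb, ?_, convex_univ, ?_⟩
  · intro x
    have hca : 0 < c + a := by linarith
    obtain ⟨R, hR⟩ : ∃ R, R = (L + c * ‖x‖) / (c + a) := ⟨_, rfl⟩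
    have hR0 : 0 ≤ R := by rw [hR]; positivity
    have hRm : (c + a) * R = L + c * ‖x‖ := by rw [hR]; field_simp
    rw [← hR]
    have : Nonempty {v : H // ‖v‖ ≤ R} := ⟨⟨0, by simpa using hR0⟩⟩
    have hb' : BddBelow (Set.range fun v : {v : H // ‖v‖ ≤ R} =>
        c / 2 * ‖(v : H) - x‖ ^ 2 + (ψ (v : H) + a / 2 * ‖(v : H)‖ ^ 2)) := by
      refine (hb x).mono ?_
      rintro _ ⟨v, rfl⟩
      exact ⟨v, rfl⟩
    apply le_antisymm
    · exact le_ciInf fun v => ciInf_le (hb x) (v : H)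
    · refine le_ciInf fun v => ?_
      by_cases hv : ‖v‖ ≤ R
      · exact ciInf_le hb' ⟨v, hv⟩
      · push Not at hv
        have hs : 0 < ‖v‖ := lt_of_le_of_lt hR0 hv
        have hw : ‖(R / ‖v‖) • v‖ = R := by
          rw [norm_smul, Real.norm_of_nonneg (by positivity)]
          field_simp
        have hd : v - (R / ‖v‖) • v = (1 - R / ‖v‖) • v := by module
        have hq : 0 ≤ 1 - R / ‖v‖ := by
          rw [sub_nonneg, div_le_one hs]; exact hv.le
        have hdn : ‖v - (R / ‖v‖) • v‖ = ‖v‖ - R := by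
          rw [hd, norm_smul, Real.norm_of_nonneg hq]
          field_simp
        refine (ciInf_le hb' ⟨(R / ‖v‖) • v, hw.le⟩).trans ?_
        simp only
        generalize (R / ‖v‖) • v = w at hw hdn
        have h1 := (abs_le.mp (hψ v w)).1
        have h2 := real_inner_le_norm (v - w) x
        rw [inner_sub_left] at h2
        rw [hdn] at h1 h2
        rw [hexp x v, hexp x w, hw]
        have h3 := mul_le_mul_of_nonneg_left h2 hc.le
        have h4 : 0 ≤ (c + a) / 2 * (‖v‖ - R) ^ 2 := by positivity
        have h5 : (c + a) * R * (‖v‖ - R) = (L + c * ‖x‖) * (‖v‖ - R) := by rw [hRm]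
        nlinarith
  · intro x _ y _ p q hp hq hpq
    simp only [smul_eq_mul]
    rw [sub_le_comm]
    refine le_ciInf fun v => ?_
    have h1 := mul_le_mul_of_nonneg_left (ciInf_le (hb x) v) hp
    have h2 := mul_le_mul_of_nonneg_left (ciInf_le (hb y) v) hq
    generalize (⨅ v : H, (c / 2 * ‖v - x‖ ^ 2 + (ψ v + a / 2 * ‖v‖ ^ 2))) = ex at *
    generalize (⨅ v : H, (c / 2 * ‖v - y‖ ^ 2 + (ψ v + a / 2 * ‖v‖ ^ 2))) = ey at *
    rw [hexp] at h1 h2 ⊢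
    rw [inner_add_right, inner_smul_right, inner_smul_right]
    obtain rfl : q = 1 - p := by linarith
    linarith
end

section
/- Let X be a metric space equipped with its Borel σ-algebra, let K be a nonempty compact metric space, and let f : X × K → ℝ be continuous. Then there exists a Borel measurable map F : X → K such that f(x, F(x)) = max_{y ∈ K} f(x, y) for every x ∈ X. -/
/-- Measurable argmax selection: if `X` is a metric space (with its Borel σ-algebra), `K` is
a nonempty compact metric space, and `f : X × K → ℝ` is continuous, then there is a Borel
measurable map `F : X → K` with `f(x, F(x)) = max_{y ∈ K} f(x, y)` for every `x`. -/
theorem measurable_argmax_selection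
    {X K : Type*} [MetricSpace X] [MeasurableSpace X] [BorelSpace X]
    [MetricSpace K] [CompactSpace K] [Nonempty K] [MeasurableSpace K] [BorelSpace K]
    (f : X × K → ℝ) (hf : Continuous f) :
    ∃ F : X → K, Measurable F ∧ ∀ x : X, ∀ y : K, f (x, y) ≤ f (x, F x) := by
  obtain ⟨g₀, hg₀, hs₀⟩ := exists_nat_bool_continuous_surjective_of_compact K
  let g : cantorSet → K := fun c => g₀ (cantorSetHomeomorphNatToBool c)
  have hg : Continuous g := hg₀.comp cantorSetHomeomorphNatToBool.continuous
  have hs : Function.Surjective g := hs₀.comp cantorSetHomeomorphNatToBool.surjective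
  haveI : CompactSpace cantorSet := isCompact_iff_compactSpace.mp isCompact_cantorSet
  let S : Set (X × cantorSet) := {p | ∀ y, f (p.1, y) ≤ f (p.1, g p.2)}
  have hS : IsClosed S := by
    simp only [S, Set.setOf_forall]
    exact isClosed_iInter fun y => isClosed_le (by fun_prop) (by fun_prop)
  have key : ∀ x, ∃ c, (x, c) ∈ S ∧ ∀ d, (x, d) ∈ S → (c : ℝ) ≤ d := by
    intro x
    have hc : IsCompact {c | (x, c) ∈ S} :=
      (hS.preimage (by fun_prop : Continuous fun c : cantorSet => (x, c))).isCompact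
    have hne : {c | (x, c) ∈ S}.Nonempty := by
      obtain ⟨y, -, hy⟩ := isCompact_univ.exists_isMaxOn (Set.univ_nonempty (α := K))
        (by fun_prop : Continuous fun y => f (x, y)).continuousOn
      obtain ⟨c, rfl⟩ := hs y
      exact ⟨c, fun z => hy (Set.mem_univ z)⟩
    obtain ⟨c, h1, h2⟩ := hc.exists_isMinOn hne continuous_subtype_val.continuousOn
    exact ⟨c, h1, fun d hd => h2 hd⟩
  choose c hc hmin using key
  refine ⟨fun x => g (c x), hg.measurable.comp ?_, fun x => hc x⟩
  have hm : Measurable fun x => (c x : ℝ) := by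
    refine measurable_of_Iic fun t => IsClosed.measurableSet ?_
    have : (fun x => (c x : ℝ)) ⁻¹' Set.Iic t = Prod.fst '' (S ∩ {p | (p.2 : ℝ) ≤ t}) := by
      ext x
      constructor
      · intro h
        exact ⟨(x, c x), ⟨hc x, h⟩, rfl⟩
      · rintro ⟨⟨x', d⟩, ⟨h1, h2⟩, rfl⟩
        exact (hmin _ d h1).trans h2
    rw [this]
    exact isClosedMap_fst_of_compactSpace _
      (hS.inter (isClosed_le (by fun_prop) continuous_const))
  exact hm.subtype_mk
end

section
/- Let 𝒰 be a free (nonprincipal) ultrafilter on ℕ, let (X, d) be a metric space, let (x_k)_{k∈ℕ} be a sequence in X converging to a point x ∈ X, and for each k let (a_{k,n})_{n∈ℕ} be a sequence in X such that a_{k,n} converges to x_k along 𝒰 (i.e., for every ε > 0 the set {n : d(a_{k,n}, x_k) < ε} belongs to 𝒰). Then there exists a function κ : ℕ → ℕ such that a_{κ(n),n} converges to x along 𝒰. -/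
/-- Diagonalization along a free ultrafilter: if `x k → xlim` (as `k → ∞`) in a metric
space, and for each `k` the sequence `n ↦ a k n` converges to `x k` along a free
ultrafilter `𝒰` on `ℕ`, then there is `κ : ℕ → ℕ` such that `n ↦ a (κ n) n`
converges to `xlim` along `𝒰`. -/
theorem ultrafilter_diagonalization
    {X : Type*} [MetricSpace X]
    (𝒰 : Ultrafilter ℕ) (h𝒰 : (𝒰 : Filter ℕ) ≤ Filter.cofinite)
    (x : ℕ → X) (xlim : X) (hx : Filter.Tendsto x Filter.atTop (nhds xlim))
    (a : ℕ → ℕ → X) (ha : ∀ k : ℕ, Filter.Tendsto (fun n => a k n) 𝒰 (nhds (x k))) :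
    ∃ κ : ℕ → ℕ, Filter.Tendsto (fun n => a (κ n) n) 𝒰 (nhds xlim) := by
  -- `κ n` minimizes the distance from `a k n` to `xlim` over `k ≤ n`.
  have hmin : ∀ n : ℕ, ∃ j : ℕ, ∀ k ≤ n, dist (a j n) xlim ≤ dist (a k n) xlim := by
    intro n
    obtain ⟨j, -, hj⟩ := Finset.exists_min_image (Finset.range (n + 1))
      (fun k => dist (a k n) xlim) ⟨0, by simp⟩
    exact ⟨j, fun k hk => hj k (by simp; omega)⟩
  choose κ hκ using hmin
  refine ⟨κ, Metric.tendsto_nhds.2 fun ε hε => ?_⟩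
  obtain ⟨k, hk⟩ := (Metric.tendsto_nhds.1 hx ε hε).exists
  have h1 : ∀ᶠ n in (𝒰 : Filter ℕ), dist (a k n) xlim < ε :=
    (ha k).eventually (Metric.isOpen_ball.mem_nhds (Metric.mem_ball.2 hk))
  have h2 : ∀ᶠ n in (𝒰 : Filter ℕ), k ≤ n := by
    rw [Nat.cofinite_eq_atTop] at h𝒰
    exact h𝒰 (Filter.eventually_ge_atTop k)
  filter_upwards [h1, h2] with n hn hkn
  exact (hκ n k hkn).trans_lt hn
end
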